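/- Let s(I) denote the least integer m such that depth I^{i−1}/I^i = depth I^i/I^{i+1} for all i ≥ m, and similarly s(J). Then for all n ≥ s(I) + s(J) − 1: depth (I+J)^{n−1}/(I+J)^n = min { lim_{i→∞} depth I^{i−1}/I^i + min_{1 ≤ j ≤ s(J)} depth J^{j−1}/J^j , min_{1 ≤ i ≤ s(I)} depth I^{i−1}/I^i + lim_{j→∞} depth J^{j−1}/J^j }. -/

import Mathlib

/-! Core definitions: depth via local cohomology at the maximal homogeneous ideal,
Castelnuovo–Mumford regularity via graded free resolutions, gradings on
subquotients of polynomial rings.  -/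

open MvPolynomial

noncomputable section

namespace PaperHTT

variable (k : Type) [Field k]

/-- A polynomial is homogeneous of degree `e : ℤ` (it must vanish in negative degrees). -/
def homogZ {σ : Type} (p : MvPolynomial σ k) (e : ℤ) : Prop :=
  p = 0 ∨ (0 ≤ e ∧ p.IsHomogeneous e.toNat)

/-- The maximal homogeneous ideal `(x_1, …, x_r)` of a polynomial ring. -/
def maxHomIdeal (σ : Type) : Ideal (MvPolynomial σ k) :=
  Ideal.span (Set.range MvPolynomial.X)

/-- The depth of a module over a polynomial ring with respect to the maximal homogeneous
ideal: the least `i` such that the `i`-th local cohomology is non-vanishing. -/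
def depthM {σ : Type} (M : ModuleCat (MvPolynomial σ k)) : ℕ :=
  sInf {i : ℕ | Nontrivial ((localCohomology (maxHomIdeal k σ) i).obj M)}

/-- The subquotient `p/q` of a polynomial ring, for ideals `q ≤ p`. -/
abbrev subQuot {σ : Type} (p q : Ideal (MvPolynomial σ k)) : Type :=
  ↥p ⧸ (Submodule.comap p.subtype q)

/-- The degree-`t` graded piece of `p/q`: the image of the homogeneous elements of
degree `t` of `p`. -/
def subQuotGr {σ : Type} (p q : Ideal (MvPolynomial σ k)) (t : ℤ) :
    AddSubgroup (subQuot k p q) :=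
  AddSubgroup.closure
    {x | ∃ f : p, homogZ k (f : MvPolynomial σ k) t ∧ x = Submodule.Quotient.mk f}

/-- The degree-`t` graded piece of the quotient ring `P/Q`. -/
def quotGr {σ : Type} (Q : Ideal (MvPolynomial σ k)) (t : ℤ) :
    AddSubgroup (MvPolynomial σ k ⧸ Q) :=
  AddSubgroup.closure {x | ∃ f, homogZ k f t ∧ x = Ideal.Quotient.mk Q f}

/-- The degree-`t` graded piece of an ideal `p`, viewed as a module. -/
def idealGr {σ : Type} (p : Ideal (MvPolynomial σ k)) (t : ℤ) : AddSubgroup ↥p :=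
  AddSubgroup.closure {x : p | homogZ k (x : MvPolynomial σ k) t}

/-- A finite graded free resolution of a module `M` over a polynomial ring,
with respect to a grading `gr` of `M`: `F_i` is free of rank `rk i`, with basis elements
of (twisted) degrees `tw i l`, the differentials and augmentation are graded of degree `0`,
and the complex `⋯ → F_1 → F_0 → M → 0` is exact. -/
structure GradedFreeRes (σ : Type) (M : Type) [AddCommGroup M]
    [Module (MvPolynomial σ k) M] (gr : ℤ → AddSubgroup M) where
  rk : ℕ → ℕ
  tw : (i : ℕ) → Fin (rk i) → ℤ
  bdd : ∃ N, ∀ i, N ≤ i → rk i = 0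
  aug : (Fin (rk 0) → MvPolynomial σ k) →ₗ[MvPolynomial σ k] M
  d : (i : ℕ) →
    ((Fin (rk (i + 1)) → MvPolynomial σ k) →ₗ[MvPolynomial σ k]
      (Fin (rk i) → MvPolynomial σ k))
  aug_surj : Function.Surjective aug
  exact_zero : LinearMap.range (d 0) = LinearMap.ker aug
  exact_succ : ∀ i, LinearMap.range (d (i + 1)) = LinearMap.ker (d i)
  aug_homog : ∀ l, aug (Pi.single l 1) ∈ gr (tw 0 l)
  d_homog : ∀ i l l', homogZ k (d i (Pi.single l 1) l') (tw (i + 1) l - tw i l')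

/-- The Castelnuovo–Mumford regularity of a (finitely generated) graded module over a
polynomial ring: the least `r` such that `M` admits a graded free resolution with all
twists in homological degree `i` at most `r + i`.  (By minimal free resolutions, this
agrees with `max {aⁱ(M) + i}`.) -/
def regM (σ : Type) (M : Type) [AddCommGroup M] [Module (MvPolynomial σ k) M]
    (gr : ℤ → AddSubgroup M) : ℤ :=
  sInf {r : ℤ | ∃ F : GradedFreeRes k σ M gr, ∀ i (l : Fin (F.rk i)), F.tw i l - (i : ℤ) ≤ r}

/-- Depth of the quotient ring `P/Q` as a module over `P`. -/
def depthQuot {σ : Type} (Q : Ideal (MvPolynomial σ k)) : ℕ :=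
  depthM k (ModuleCat.of (MvPolynomial σ k) (MvPolynomial σ k ⧸ Q))

/-- Depth of the subquotient `p/q` as a module over the polynomial ring. -/
def depthSubQuot {σ : Type} (p q : Ideal (MvPolynomial σ k)) : ℕ :=
  depthM k (ModuleCat.of (MvPolynomial σ k) (subQuot k p q))

/-- Depth of an ideal `p` as a module over the polynomial ring. -/
def depthIdeal {σ : Type} (p : Ideal (MvPolynomial σ k)) : ℕ :=
  depthM k (ModuleCat.of (MvPolynomial σ k) ↥p)

/-- Regularity of the quotient ring `P/Q`. -/
def regQuot {σ : Type} (Q : Ideal (MvPolynomial σ k)) : ℤ :=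
  regM k σ (MvPolynomial σ k ⧸ Q) (quotGr k Q)

/-- Regularity of the subquotient `p/q`. -/
def regSubQuot {σ : Type} (p q : Ideal (MvPolynomial σ k)) : ℤ :=
  regM k σ (subQuot k p q) (subQuotGr k p q)

/-- Regularity of an ideal `p`, viewed as a graded module. -/
def regIdeal {σ : Type} (p : Ideal (MvPolynomial σ k)) : ℤ :=
  regM k σ (↥p) (idealGr k p)

/-- A homogeneous ideal: one containing all homogeneous components of its elements. -/
def IsHomogeneousIdeal {σ : Type} (I : Ideal (MvPolynomial σ k)) : Prop :=
  ∀ f ∈ I, ∀ m : ℕ, MvPolynomial.homogeneousComponent m f ∈ I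

/-- A monomial ideal. -/
def IsMonomialIdeal {σ : Type} (I : Ideal (MvPolynomial σ k)) : Prop :=
  ∃ S : Set (σ →₀ ℕ), I = Ideal.span ((fun a => MvPolynomial.monomial a (1 : k)) '' S)

/-- A squarefree monomial ideal. -/
def IsSquarefreeMonomialIdeal {σ : Type} (I : Ideal (MvPolynomial σ k)) : Prop :=
  ∃ S : Set (σ →₀ ℕ), (∀ a ∈ S, ∀ x, a x ≤ 1) ∧
    I = Ideal.span ((fun a => MvPolynomial.monomial a (1 : k)) '' S)

/-- The quotient ring `P/Q` is Cohen–Macaulay: its depth equals its Krull dimension. -/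
def IsCMQuot {σ : Type} (Q : Ideal (MvPolynomial σ k)) : Prop :=
  (depthQuot k Q : WithBot (WithTop ℕ)) = ringKrullDim (MvPolynomial σ k ⧸ Q)

/-- An isomorphism of graded modules: a linear isomorphism matching up the gradings. -/
def GradedIso {P : Type} [CommRing P] {M N : Type} [AddCommGroup M] [Module P M]
    [AddCommGroup N] [Module P N] (grM : ℤ → AddSubgroup M) (grN : ℤ → AddSubgroup N) :
    Prop :=
  ∃ e : M ≃ₗ[P] N, ∀ t, (grM t).map e.toLinearMap.toAddMonoidHom = grN t

/-- `gr` is an (internal, ℤ-) grading of the module `M` over a polynomial ring,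
compatible with the standard grading of the polynomial ring. -/
def IsGrading (σ : Type) {M : Type} [AddCommGroup M] [Module (MvPolynomial σ k) M]
    (gr : ℤ → AddSubgroup M) : Prop :=
  DirectSum.IsInternal (fun t : ℤ => gr t) ∧
    ∀ (p : MvPolynomial σ k) (d : ℕ) (t : ℤ) (m : M), p.IsHomogeneous d → m ∈ gr t →
      p • m ∈ gr (t + d)

/-- The polynomial ring `A = k[x_1,…,x_r]`. -/
abbrev PA (r : ℕ) : Type := MvPolynomial (Fin r) k

/-- The polynomial ring `B = k[y_1,…,y_s]`. -/
abbrev PB (s : ℕ) : Type := MvPolynomial (Fin s) k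

/-- The polynomial ring `R = k[x_1,…,x_r,y_1,…,y_s]`. -/
abbrev PR (r s : ℕ) : Type := MvPolynomial (Fin r ⊕ Fin s) k

/-- The extension of an ideal `I ⊆ A` to `R`. -/
def extA {r s : ℕ} (I : Ideal (PA k r)) : Ideal (PR k r s) :=
  I.map (MvPolynomial.rename (Sum.inl : Fin r → Fin r ⊕ Fin s))

/-- The extension of an ideal `J ⊆ B` to `R`. -/
def extB {r s : ℕ} (J : Ideal (PB k s)) : Ideal (PR k r s) :=
  J.map (MvPolynomial.rename (Sum.inr : Fin s → Fin r ⊕ Fin s))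

/-- The ideal `I + J ⊆ R`. -/
def sumIJ {r s : ℕ} (I : Ideal (PA k r)) (J : Ideal (PB k s)) : Ideal (PR k r s) :=
  extA k I + extB k J

end PaperHTT

end

section

open CategoryTheory Limits Opposite

variable {R : Type} [CommRing R]

/-- The map of Yoneda complexes induced by a map of chain complexes. -/
abbrev yonedaComplexMap {K L : ChainComplex (ModuleCat.{0} R) ℕ} (φ : K ⟶ L) (Y : ModuleCat.{0} R) :
    L.linearYonedaObj R Y ⟶ K.linearYonedaObj R Y :=
  (HomologicalComplex.unopFunctor (ModuleCat.{0} R) _).map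
    ((((linearYoneda R (ModuleCat.{0} R)).obj Y).rightOp.mapHomologicalComplex _).map φ).op

theorem square_paste {C : Type*} [Category C] {A A' B B' D D' : C} {a : A ⟶ A'} {u : A ⟶ B}
    {u' : A' ⟶ B'} {H : B ⟶ B'} {w : D ≅ B} {w' : D' ≅ B'} {m : D ⟶ D'}
    (h₁ : a ≫ u' = u ≫ H) (h₂ : w.hom ≫ H = m ≫ w'.hom) :
    a ≫ (u' ≫ w'.inv) = (u ≫ w.inv) ≫ m := by
  rw [← Category.assoc, h₁, Category.assoc, Category.assoc]
  congr 1
  rw [Iso.comp_inv_eq, Category.assoc, Iso.eq_inv_comp, h₂]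

theorem isoExt_hom_naturality {X X' : ModuleCat.{0} R} (P : ProjectiveResolution X)
    (P' : ProjectiveResolution X')
    (g : X' ⟶ X) (φ : P'.complex ⟶ P.complex) (comm : φ.f 0 ≫ P.π.f 0 = P'.π.f 0 ≫ g)
    (n : ℕ) (Y : ModuleCat.{0} R) :
    ((Ext R (ModuleCat.{0} R) n).map g.op).app Y ≫ (P'.isoExt n Y).hom =
      (P.isoExt n Y).hom ≫ HomologicalComplex.homologyMap (yonedaComplexMap φ Y) n := by
  have h₁ := congrArg Quiver.Hom.unop
    (ProjectiveResolution.isoLeftDerivedObj_inv_naturality g P' P φ comm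
      ((linearYoneda R (ModuleCat.{0} R)).obj Y).rightOp n)
  have h₂ := congrArg Quiver.Hom.unop
    (HomologicalComplex.homologyOp_hom_naturality (yonedaComplexMap φ Y) n)
  exact square_paste (w := ((P.complex.linearYonedaObj R Y).homologyOp n).unop)
    (w' := ((P'.complex.linearYonedaObj R Y).homologyOp n).unop) h₁ h₂

/-- The cochain `f` represents the class `x` in the homology of a complex of modules. -/
def RepresentsClass (K : CochainComplex (ModuleCat.{0} R) ℕ) (n : ℕ) (f : K.X n)
    (x : K.homology n) : Prop :=
  ∃ c : K.cycles n, (K.iCycles n).hom c = f ∧ (K.homologyπ n).hom c = x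

namespace RepresentsClass

variable {K L : CochainComplex (ModuleCat.{0} R) ℕ} {n : ℕ} {f : K.X n} {x : K.homology n}

theorem exists_cochain (x : K.homology n) :
    ∃ f, (K.d n (n + 1)).hom f = 0 ∧ RepresentsClass K n f x := by
  obtain ⟨c, rfl⟩ := (ModuleCat.epi_iff_surjective (K.homologyπ n)).1 inferInstance x
  refine ⟨(K.iCycles n).hom c, ?_, c, rfl, rfl⟩
  have := K.iCycles_d n (n + 1)
  exact congr($(this).hom c)

theorem exists_class (hf : (K.d n (n + 1)).hom f = 0) : ∃ x, RepresentsClass K n f x := by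
  have h : ModuleCat.ofHom (LinearMap.toSpanSingleton R _ f) ≫ K.d n (n + 1) = 0 := by
    ext
    simpa using hf
  refine ⟨_, (K.liftCycles (ModuleCat.ofHom (LinearMap.toSpanSingleton R _ f)) (n + 1)
    (by simp) h).hom (1 : R), ?_, rfl⟩
  have := K.liftCycles_i (ModuleCat.ofHom (LinearMap.toSpanSingleton R _ f)) (n + 1) (by simp) h
  have := congr($(this).hom (1 : R))
  exact this.trans (one_smul R f)

theorem eq_zero_iff (h : RepresentsClass K n f x) :
    x = 0 ↔ ∃ g, (K.d ((ComplexShape.up ℕ).prev n) n).hom g = f := by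
  obtain ⟨c, rfl, rfl⟩ := h
  have hex := (ShortComplex.exact_of_g_is_cokernel
      (ShortComplex.mk _ _ (K.toCycles_comp_homologyπ ((ComplexShape.up ℕ).prev n) n))
      (K.homologyIsCokernel _ n rfl))
  rw [ShortComplex.moduleCat_exact_iff] at hex
  constructor
  · intro h
    obtain ⟨g, hg⟩ := hex c h
    refine ⟨g, ?_⟩
    rw [← K.toCycles_i]
    exact congrArg (K.iCycles n).hom hg
  · rintro ⟨g, hg⟩
    have : (K.toCycles ((ComplexShape.up ℕ).prev n) n).hom g = c := by
      apply (ModuleCat.mono_iff_injective (K.iCycles n)).1 inferInstance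
      rw [← K.toCycles_i] at hg
      exact hg
    rw [← this]
    exact congr($(K.toCycles_comp_homologyπ ((ComplexShape.up ℕ).prev n) n).hom g)

theorem map (h : RepresentsClass K n f x) (φ : K ⟶ L) :
    RepresentsClass L n ((φ.f n).hom f) ((HomologicalComplex.homologyMap φ n).hom x) := by
  obtain ⟨c, rfl, rfl⟩ := h
  refine ⟨(HomologicalComplex.cyclesMap φ n).hom c, ?_, ?_⟩
  · exact congr($(HomologicalComplex.cyclesMap_i φ n).hom c)
  · exact (congr($(HomologicalComplex.homologyπ_naturality φ n).hom c)).symm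

end RepresentsClass

theorem extMk_eq_zero_iff_exists_prev {X Y : ModuleCat.{0} R} (P : ProjectiveResolution X) {n : ℕ}
    (f : P.complex.X n ⟶ Y) (hf : P.complex.d (n + 1) n ≫ f = 0) :
    P.extMk f (n + 1) rfl hf = 0 ↔
      ∃ g, ((P.complex.linearYonedaObj R Y).d ((ComplexShape.up ℕ).prev n) n).hom g = f := by
  cases n with
  | succ p =>
    rw [P.extMk_eq_zero_iff f _ rfl hf p rfl, CochainComplex.prev_nat_succ]
    rfl
  | zero =>
    have h0 : (P.complex.linearYonedaObj R Y).d ((ComplexShape.up ℕ).prev 0) 0 = 0 := by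
      rw [HomologicalComplex.shape]
      simp
    rw [h0]
    constructor
    · intro h
      refine ⟨0, ?_⟩
      have h1 := P.extEquivCohomologyClass_extMk f 1 rfl hf
      rw [h, ProjectiveResolution.extEquivCohomologyClass_zero, eq_comm,
        CochainComplex.HomComplex.CohomologyClass.mk_eq_zero_iff,
        CochainComplex.HomComplex.Cocycle.toSingleMk_mem_coboundaries_iff _ _ _ _ _ 1 (by simp)] at h1
      obtain ⟨g, hg⟩ := h1
      have hz : IsZero (P.cochainComplex.X 1) := by
        exact P.cochainComplex.isZero_of_isStrictlyLE 0 1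
      have hg0 : g = 0 := hz.eq_of_src _ _
      rw [hg0, comp_zero, eq_comm] at hg
      have : f = 0 := by
        rw [← cancel_epi (P.cochainComplexXIso (-(0 : ℕ)) 0 rfl).hom, hg, comp_zero]
      rw [this]; rfl
    · rintro ⟨g, hg⟩
      have : f = 0 := hg.symm
      subst this
      simp

/-- A class in `Ext R C n` and one in `Abelian.Ext` that vanish after the same pullbacks. -/
def SamePullbackVanishing {X Y : ModuleCat.{0} R} {n : ℕ}
    (x : ((Ext R (ModuleCat.{0} R) n).obj (op X)).obj Y) (ξ : Abelian.Ext X Y n) : Prop :=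
  ∀ ⦃X' : ModuleCat.{0} R⦄ (g : X' ⟶ X),
    (((Ext R (ModuleCat.{0} R) n).map g.op).app Y).hom x = 0 ↔
      (Abelian.Ext.mk₀ g).comp ξ (zero_add n) = 0

theorem samePullbackVanishing_of_cocycle {X Y : ModuleCat.{0} R} (P : ProjectiveResolution X)
    {n : ℕ} {x : ((Ext R (ModuleCat.{0} R) n).obj (op X)).obj Y}
    (f : P.complex.X n ⟶ Y) (hf : P.complex.d (n + 1) n ≫ f = 0)
    (hx : RepresentsClass (P.complex.linearYonedaObj R Y) n f ((P.isoExt n Y).hom.hom x)) :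
    SamePullbackVanishing x (P.extMk f (n + 1) rfl hf) := by
  intro X' g
  let P' := projectiveResolution X'
  let φ := ProjectiveResolution.lift g P' P
  have comm := ProjectiveResolution.lift_commutes_zero g P' P
  rw [ProjectiveResolution.mk₀_comp_extMk (R' := P') (g := g) f (n + 1) rfl hf
    { hom := φ, hom_f_zero_comp_π_f_zero := comm },
    extMk_eq_zero_iff_exists_prev]
  have h := hx.map (yonedaComplexMap φ Y)
  have hnat := congr($(isoExt_hom_naturality P P' g φ comm n Y).hom x)
  simp only [ModuleCat.hom_comp, LinearMap.comp_apply] at hnat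
  rw [← hnat] at h
  have h2 := h.eq_zero_iff
  rw [← LinearMap.map_zero (P'.isoExt n Y).hom.hom] at h2
  rw [((ModuleCat.mono_iff_injective (P'.isoExt (R := R) n Y).hom).1 inferInstance).eq_iff] at h2
  exact h2

theorem exists_abelianExt_samePullbackVanishing {X Y : ModuleCat.{0} R} {n : ℕ}
    (x : ((Ext R (ModuleCat.{0} R) n).obj (op X)).obj Y) :
    ∃ ξ : Abelian.Ext X Y n, SamePullbackVanishing x ξ := by
  let P := projectiveResolution X
  obtain ⟨f, hf, hx⟩ := RepresentsClass.exists_cochain ((P.isoExt n Y).hom.hom x)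
  exact ⟨_, samePullbackVanishing_of_cocycle P f hf hx⟩

theorem exists_ext_samePullbackVanishing {X Y : ModuleCat.{0} R} {n : ℕ}
    (ξ : Abelian.Ext X Y n) :
    ∃ x : ((Ext R (ModuleCat.{0} R) n).obj (op X)).obj Y, SamePullbackVanishing x ξ := by
  let P := projectiveResolution X
  obtain ⟨f, hf, rfl⟩ := P.extMk_surjective ξ (n + 1) rfl
  obtain ⟨y, hy⟩ := RepresentsClass.exists_class (K := P.complex.linearYonedaObj R Y)
    (n := n) (f := f) hf
  refine ⟨(P.isoExt n Y).inv.hom y, samePullbackVanishing_of_cocycle P f hf ?_⟩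
  convert hy
  exact congr($((P.isoExt (R := R) n Y).inv_hom_id).hom y)

/-- The module `R ⧸ m ^ t`. -/
abbrev powQuot (m : Ideal R) (t : ℕ) : ModuleCat.{0} R :=
  (localCohomology.ringModIdeals (localCohomology.idealPowersDiagram m)).obj (op t)

/-- The projection from a quotient by a larger power of `m` to one by a smaller power. -/
abbrev powQuotProj (m : Ideal R) {t t' : ℕ} (h : t ≤ t') : powQuot m t' ⟶ powQuot m t :=
  (localCohomology.ringModIdeals (localCohomology.idealPowersDiagram m)).map (homOfLE h).op

/-- Some class in `Ext (R ⧸ m ^ t) M i` survives all pullbacks to higher powers of `m`. -/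
def HasSurvivingExt (m : Ideal R) (i : ℕ) (M : ModuleCat.{0} R) : Prop :=
  ∃ (t : ℕ) (ξ : Abelian.Ext (powQuot m t) M i), ∀ (t' : ℕ) (h : t ≤ t'),
    (Abelian.Ext.mk₀ (powQuotProj m h)).comp ξ (zero_add i) ≠ 0

theorem nontrivial_localCohomology_iff (m : Ideal R) (i : ℕ) (M : ModuleCat.{0} R) :
    Nontrivial ((localCohomology m i).obj M) ↔ HasSurvivingExt m i M := by
  let D := localCohomology.diagram (localCohomology.idealPowersDiagram m) i
  let F : ℕᵒᵖᵒᵖ ⥤ ModuleCat.{0} R := D ⋙ (evaluation _ _).obj M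
  have e : (localCohomology m i).obj M ≅ colimit F :=
    colimitObjIsoColimitCompEvaluation D M
  rw [e.toLinearEquiv.toEquiv.nontrivial_congr]
  have hmap : ∀ (t t' : ℕ) (h : t ≤ t') (f : (op (op t) : ℕᵒᵖᵒᵖ) ⟶ op (op t'))
     (x : F.obj (op (op t))), (F.map f).hom x =
      (((Ext R (ModuleCat.{0} R) i).map (powQuotProj m h).op).app M).hom x := by
    intro t t' h f x
    have : f = (homOfLE h).op.op := Subsingleton.elim _ _
    subst this
    rfl
  constructor
  · intro hn
    obtain ⟨y, hy⟩ := exists_ne (0 : (colimit F : ModuleCat.{0} R))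
    obtain ⟨⟨⟨t⟩⟩, x, rfl⟩ := Concrete.colimit_exists_rep F y
    obtain ⟨ξ, hξ⟩ := exists_abelianExt_samePullbackVanishing (X := powQuot m t) (Y := M) (n := i) x
    refine ⟨t, ξ, fun t' h h0 ↦ hy ?_⟩
    rw [← hξ, ← hmap t t' h (homOfLE h).op.op x] at h0
    rw [← colimit.w F (homOfLE h).op.op]
    change (colimit.ι F (op (op t'))).hom ((F.map (homOfLE h).op.op).hom x) = 0
    rw [h0]
    exact map_zero (colimit.ι F (op (op t'))).hom
  · rintro ⟨t, ξ, hξ⟩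
    obtain ⟨x, hx⟩ := exists_ext_samePullbackVanishing ξ
    refine nontrivial_of_ne ((colimit.ι F (op (op t))).hom x) 0 fun h0 ↦ ?_
    obtain ⟨⟨⟨t'⟩⟩, f, hf⟩ := Concrete.colimit_rep_eq_zero (R := R) F (op (op t)) x h0
    have h : t ≤ t' := leOfHom f.unop.unop
    exact hξ t' h ((hx _).1 ((hmap t t' h f x).symm.trans hf))

theorem powQuotProj_comp (m : Ideal R) {t t' t'' : ℕ} (h : t ≤ t') (h' : t' ≤ t'') :
    powQuotProj m h' ≫ powQuotProj m h = powQuotProj m (h.trans h') := by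
  rw [powQuotProj, powQuotProj, powQuotProj, ← Functor.map_comp]
  rfl

/-- An `Ext` class on `R ⧸ m ^ t` that vanishes after pullback to some higher power of `m`. -/
def Dies {m : Ideal R} {t i : ℕ} {M : ModuleCat.{0} R} (ξ : Abelian.Ext (powQuot m t) M i) : Prop :=
  ∃ (t' : ℕ) (h : t ≤ t'), (Abelian.Ext.mk₀ (powQuotProj m h)).comp ξ (zero_add i) = 0

theorem hasSurvivingExt_iff {m : Ideal R} {i : ℕ} {M : ModuleCat.{0} R} :
    HasSurvivingExt m i M ↔ ∃ (t : ℕ) (ξ : Abelian.Ext (powQuot m t) M i), ¬ Dies ξ := by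
  simp [HasSurvivingExt, Dies]

theorem not_hasSurvivingExt_iff {m : Ideal R} {i : ℕ} {M : ModuleCat.{0} R} :
    ¬ HasSurvivingExt m i M ↔ ∀ (t : ℕ) (ξ : Abelian.Ext (powQuot m t) M i), Dies ξ := by
  simp [hasSurvivingExt_iff]

namespace Dies

variable {m : Ideal R} {t i : ℕ} {M N : ModuleCat.{0} R}

theorem zero : Dies (0 : Abelian.Ext (powQuot m t) M i) :=
  ⟨t, le_rfl, by simp⟩

theorem of_pullback {t' : ℕ} {ξ : Abelian.Ext (powQuot m t) M i} (h : t ≤ t')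
    (hd : Dies ((Abelian.Ext.mk₀ (powQuotProj m h)).comp ξ (zero_add i))) : Dies ξ := by
  obtain ⟨t'', h', hd⟩ := hd
  refine ⟨t'', h.trans h', ?_⟩
  rw [Abelian.Ext.mk₀_comp_mk₀_assoc, powQuotProj_comp] at hd
  exact hd

theorem comp {ξ : Abelian.Ext (powQuot m t) M i} (hd : Dies ξ) {j l : ℕ}
    (η : Abelian.Ext M N j) (hl : i + j = l) : Dies (ξ.comp η hl) := by
  obtain ⟨t', h, hd⟩ := hd
  refine ⟨t', h, ?_⟩
  rw [← Abelian.Ext.comp_assoc _ _ _ (zero_add i) hl (by omega), hd, Abelian.Ext.zero_comp]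

theorem add {ξ η : Abelian.Ext (powQuot m t) M i} (hξ : Dies ξ) (hη : Dies η) : Dies (ξ + η) := by
  obtain ⟨a, ha, hξ⟩ := hξ
  obtain ⟨b, hb, hη⟩ := hη
  refine ⟨max a b, ha.trans (le_max_left a b), ?_⟩
  rw [Abelian.Ext.comp_add, ← powQuotProj_comp m ha (le_max_left a b),
    ← Abelian.Ext.mk₀_comp_mk₀_assoc, hξ, powQuotProj_comp m ha (le_max_left a b)]
  have : powQuotProj m (ha.trans (le_max_left a b)) =
    powQuotProj m (le_max_right a b) ≫ powQuotProj m hb := by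
    rw [powQuotProj_comp]
  rw [this, ← Abelian.Ext.mk₀_comp_mk₀_assoc, hη]
  simp

end Dies

section ShortExact

variable {m : Ideal R} {S : ShortComplex (ModuleCat.{0} R)} {x : R}

theorem pow_smul_ext_eq_zero (hx : x ∈ m) {t i : ℕ} {M : ModuleCat.{0} R}
    (ξ : Abelian.Ext (powQuot m t) M i) : x ^ t • ξ = 0 := by
  have h : x ^ t • 𝟙 (powQuot m t) = 0 := by
    ext y
    obtain ⟨y, rfl⟩ := Ideal.Quotient.mk_surjective y
    change Ideal.Quotient.mk (m ^ t) (x ^ t * y) = 0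
    exact Ideal.Quotient.eq_zero_iff_mem.2 (Ideal.mul_mem_right _ _ (Ideal.pow_mem_pow hx t))
  conv_lhs => rw [← Abelian.Ext.mk₀_id_comp ξ]
  rw [← Abelian.Ext.smul_comp, ← Abelian.Ext.mk₀_smul, h, Abelian.Ext.mk₀_zero,
    Abelian.Ext.zero_comp]

theorem not_hasSurvivingExt_zero {M : ModuleCat.{0} R} (hx : x ∈ m) (hreg : IsSMulRegular M x) :
    ¬ HasSurvivingExt m 0 M := by
  rw [not_hasSurvivingExt_iff]
  intro t ξ
  have h0 := pow_smul_ext_eq_zero hx ξ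
  obtain ⟨f, rfl⟩ := (Abelian.Ext.mk₀_bijective _ _).2 ξ
  rw [← Abelian.Ext.mk₀_smul, Abelian.Ext.mk₀_eq_zero_iff] at h0
  have : f = 0 := by
    ext y
    apply hreg.pow t
    exact (congr($(h0).hom y) : x ^ t • f.hom y = 0).trans (smul_zero (x ^ t)).symm
  rw [this, Abelian.Ext.mk₀_zero]
  exact Dies.zero

theorem not_hasSurvivingExt_succ {M : ModuleCat.{0} R} (f : M ⟶ M) (hf : f = x • 𝟙 M)
    {N : ModuleCat.{0} R} (g : M ⟶ N) (w : f ≫ g = 0) (hS : (ShortComplex.mk f g w).ShortExact)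
    (hx : x ∈ m) {i : ℕ} (h : ¬ HasSurvivingExt m i N) : ¬ HasSurvivingExt m (i + 1) M := by
  rw [not_hasSurvivingExt_iff] at h ⊢
  have key : ∀ (j t : ℕ) (ξ : Abelian.Ext (powQuot m t) M (i + 1)), x ^ j • ξ = 0 → Dies ξ := by
    intro j
    induction j with
    | zero =>
      intro t ξ hξ
      rw [pow_zero, one_smul] at hξ
      exact hξ ▸ Dies.zero
    | succ j ih =>
      intro t ξ hξ
      have h1 : (x ^ j • ξ).comp (Abelian.Ext.mk₀ f) (add_zero _) = 0 := by
        rw [hf, ← Abelian.Ext.smul_eq_comp_mk₀, smul_smul, ← pow_succ', hξ]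
      obtain ⟨y, hy⟩ := Abelian.Ext.covariant_sequence_exact₁ _ hS (x ^ j • ξ) h1 rfl
      obtain ⟨t', ht, hd⟩ := h t y
      refine Dies.of_pullback ht (ih _ _ ?_)
      rw [← Abelian.Ext.comp_smul, ← hy,
        ← Abelian.Ext.comp_assoc _ _ _ (zero_add i) rfl (by omega), hd, Abelian.Ext.zero_comp]
  exact fun t ξ ↦ key t t ξ (pow_smul_ext_eq_zero hx ξ)

theorem hasSurvivingExt_succ (hS : S.ShortExact) {i : ℕ}
    (h : ¬ HasSurvivingExt m i S.X₂) (h' : HasSurvivingExt m i S.X₃) :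
    HasSurvivingExt m (i + 1) S.X₁ := by
  rw [not_hasSurvivingExt_iff] at h
  rw [hasSurvivingExt_iff] at h' ⊢
  obtain ⟨t, y, hy⟩ := h'
  refine ⟨t, y.comp hS.extClass rfl, fun ⟨t', ht, hd⟩ ↦ hy ?_⟩
  rw [← Abelian.Ext.comp_assoc _ _ _ (zero_add i) rfl (by omega)] at hd
  obtain ⟨z, hz⟩ := Abelian.Ext.covariant_sequence_exact₃ _ hS _ rfl hd
  refine Dies.of_pullback ht ?_
  rw [← hz]
  exact (h _ z).comp _ _

end ShortExact

theorem hasSurvivingExt_zero {m : Ideal R} {M : ModuleCat.{0} R} {z : M} (hz : z ≠ 0)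
    (hm : ∀ x ∈ m, x • z = 0) : HasSurvivingExt m 0 M := by
  have hle : m ^ 1 ≤ LinearMap.ker (LinearMap.toSpanSingleton R M z) := by
    intro x hx
    rw [pow_one] at hx
    exact hm x hx
  let f : powQuot m 1 ⟶ M := ModuleCat.ofHom ((m ^ 1).liftQ (LinearMap.toSpanSingleton R M z) hle)
  refine ⟨1, Abelian.Ext.mk₀ f, fun t' h h0 ↦ hz ?_⟩
  rw [Abelian.Ext.mk₀_comp_mk₀, Abelian.Ext.mk₀_eq_zero_iff] at h0
  have : (1 : R) • z = 0 := congr($(h0).hom (Ideal.Quotient.mk (m ^ t') 1))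
  rwa [one_smul] at this

theorem HasSurvivingExt.of_comp_ne {m : Ideal R} {i : ℕ} {ι : Type} [Fintype ι]
    {M : ModuleCat.{0} R} {N : ι → ModuleCat.{0} R} (p : ∀ l, M ⟶ N l) (q : ∀ l, N l ⟶ M)
    (hpq : ∑ l, p l ≫ q l = 𝟙 M) (h : HasSurvivingExt m i M) : ∃ l, HasSurvivingExt m i (N l) := by
  by_contra! hN
  simp_rw [not_hasSurvivingExt_iff] at hN
  revert h
  change ¬ _
  rw [not_hasSurvivingExt_iff]
  intro t ξ
  have : ξ = ∑ l, (ξ.comp (Abelian.Ext.mk₀ (p l)) (add_zero i)).comp (Abelian.Ext.mk₀ (q l))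
      (add_zero i) := by
    conv_lhs => rw [← Abelian.Ext.comp_mk₀_id ξ, ← hpq, Abelian.Ext.mk₀_sum, Abelian.Ext.comp_sum]
    refine Finset.sum_congr rfl fun l _ ↦ ?_
    rw [Abelian.Ext.comp_assoc_of_third_deg_zero, Abelian.Ext.mk₀_comp_mk₀]
  rw [this]
  refine Finset.sum_induction _ Dies (fun _ _ ↦ Dies.add) Dies.zero fun l _ ↦ ?_
  exact (hN l t _).comp _ _

theorem HasSurvivingExt.of_retract {m : Ideal R} {i : ℕ} {M N : ModuleCat.{0} R}
    (p : M ⟶ N) (q : N ⟶ M) (hpq : p ≫ q = 𝟙 M) (h : HasSurvivingExt m i M) :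
    HasSurvivingExt m i N := by
  obtain ⟨-, h⟩ := h.of_comp_ne (ι := Unit) (N := fun _ ↦ N) (fun _ ↦ p) (fun _ ↦ q) (by simpa)
  exact h

/-- `M` has a regular sequence of length `d` in the ideal `m` ending in a module with an element
annihilated by `m`. -/
inductive HasDepth (m : Ideal R) : ℕ → (M : Type) → [AddCommGroup M] → [Module R M] → Prop
  | zero {M : Type} [AddCommGroup M] [Module R M] {z : M} (hz : z ≠ 0)
      (hm : ∀ x ∈ m, x • z = 0) : HasDepth m 0 M
  | succ {d : ℕ} {M N : Type} [AddCommGroup M] [Module R M] [AddCommGroup N] [Module R N] {x : R}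
      (hx : x ∈ m) (hreg : IsSMulRegular M x) (π : M →ₗ[R] N) (hπ : Function.Surjective π)
      (hex : Function.Exact (LinearMap.lsmul R M x) π) (h : HasDepth m d N) : HasDepth m (d + 1) M

theorem HasDepth.hasSurvivingExt {m : Ideal R} {d : ℕ} {M : Type} [AddCommGroup M] [Module R M]
    (h : HasDepth m d M) : HasSurvivingExt m d (ModuleCat.of R M) ∧
      ∀ i < d, ¬ HasSurvivingExt m i (ModuleCat.of R M) := by
  induction h with
  | zero hz hm => exact ⟨hasSurvivingExt_zero (M := ModuleCat.of R _) hz hm, by simp⟩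
  | @succ d M N _ _ _ _ x hx hreg π hπ hex h ih =>
    have hS : (ModuleCat.shortComplexOfCompEqZero _ _ hex.linearMap_comp_eq_zero).ShortExact :=
      { exact := ModuleCat.shortComplex_exact _ hex
        mono_f := (ModuleCat.mono_iff_injective _).2 hreg
        epi_g := (ModuleCat.epi_iff_surjective _).2 hπ }
    have hlow : ∀ i < d + 1, ¬ HasSurvivingExt m i (ModuleCat.of R M) := by
      rintro (_ | i) hi
      · exact not_hasSurvivingExt_zero hx hreg
      · exact not_hasSurvivingExt_succ _ rfl _ _ hS hx (ih.2 i (by omega))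
    exact ⟨hasSurvivingExt_succ hS (hlow d (by omega)) ih.1, hlow⟩

theorem exists_hasDepth [IsNoetherianRing R] {m : Ideal R} {M : Type} [AddCommGroup M] [Module R M]
    [Module.Finite R M] (hM : m • (⊤ : Submodule R M) ≠ ⊤) : ∃ d, HasDepth m d M := by
  have key : ∀ K : Submodule R M, K ⊔ m • ⊤ ≠ ⊤ → ∀ (N : Type) [AddCommGroup N] [Module R N]
      (π : M →ₗ[R] N), Function.Surjective π → LinearMap.ker π = K → ∃ d, HasDepth m d N := by
    intro K
    induction K using WellFoundedGT.induction with
    | ind K ih =>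
      intro hK N _ _ π hπ hker
      have : Module.Finite R N := Module.Finite.of_surjective π hπ
      by_cases hz : ∃ z : N, z ≠ 0 ∧ ∀ x ∈ m, x • z = 0
      · obtain ⟨z, hz, hm⟩ := hz
        exact ⟨0, .zero hz hm⟩
      push Not at hz
      have hsub : Subsingleton ((R ⧸ m) →ₗ[R] N) := by
        refine subsingleton_of_forall_eq 0 fun f ↦ ?_
        by_contra hf
        have h1 : f 1 ≠ 0 := by
          intro h1
          apply hf
          ext
          exact h1
        obtain ⟨x, hx, hx1⟩ := hz _ h1
        apply hx1
        rw [← map_smul]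
        convert map_zero f
        rw [Algebra.smul_def, mul_one]
        exact Ideal.Quotient.eq_zero_iff_mem.2 hx
      obtain ⟨x, hx, hreg⟩ := IsSMulRegular.subsingleton_linearMap_iff.1 hsub
      rw [Ideal.annihilator_quotient] at hx
      let q : N →ₗ[R] N ⧸ LinearMap.range (LinearMap.lsmul R N x) := Submodule.mkQ _
      have hq : Function.Surjective q := Submodule.mkQ_surjective _
      have hlt : K < LinearMap.ker (q ∘ₗ π) := by
        rw [lt_iff_le_and_ne]
        constructor
        · rw [← hker]
          exact LinearMap.ker_le_ker_comp _ _
        · intro heq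
          apply hK
          rw [eq_top_iff]
          rintro y -
          refine Submodule.mem_sup_left ?_
          have h1 : x • y ∈ K := by
            rw [heq, LinearMap.mem_ker, LinearMap.comp_apply, Submodule.mkQ_apply,
              Submodule.Quotient.mk_eq_zero]
            exact ⟨π y, (map_smul π x y).symm⟩
          rw [← hker, LinearMap.mem_ker, map_smul] at h1
          rw [← hker, LinearMap.mem_ker]
          exact hreg (h1.trans (smul_zero x).symm)
      have hle : LinearMap.ker (q ∘ₗ π) ≤ K ⊔ m • ⊤ := by
        intro y hy
        simp only [LinearMap.mem_ker, LinearMap.comp_apply, q, Submodule.mkQ_apply,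
          Submodule.Quotient.mk_eq_zero, LinearMap.mem_range, LinearMap.lsmul_apply] at hy
        obtain ⟨w, hw⟩ := hy
        obtain ⟨u, rfl⟩ := hπ w
        rw [← sub_add_cancel y (x • u)]
        refine Submodule.add_mem_sup ?_ (Submodule.smul_mem_smul hx trivial)
        rw [← hker, LinearMap.mem_ker, map_sub, map_smul, hw, sub_self]
      obtain ⟨d, hd⟩ := ih _ hlt
        (fun h ↦ hK (top_unique (h.symm.le.trans (sup_le hle le_sup_right)))) _ (q ∘ₗ π)
        (hq.comp hπ) rfl
      exact ⟨d + 1, .succ hx hreg q hq (LinearMap.exact_map_mkQ_range _) hd⟩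
  exact key ⊥ (by simpa using hM) M LinearMap.id Function.surjective_id LinearMap.ker_id

section Tensor

open TensorProduct

variable {k P Q : Type} [Field k] [CommRing P] [CommRing Q] [Algebra k P] [Algebra k Q]
  [Algebra k R]

/-- An identification of the `R`-module `T` with the external tensor product over `k` of the
`P`-module `M` and the `Q`-module `N`. -/
structure BoxTensor (f : P →ₐ[k] R) (g : Q →ₐ[k] R) (M N T : Type) [AddCommGroup M]
    [AddCommGroup N] [AddCommGroup T] [Module P M] [Module Q N] [Module R T]
    [Module k M] [Module k N] [Module k T] where
  equiv : M ⊗[k] N ≃ₗ[k] T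
  left_smul (a : P) (x : M) (y : N) : equiv ((a • x) ⊗ₜ y) = f a • equiv (x ⊗ₜ y)
  right_smul (b : Q) (x : M) (y : N) : equiv (x ⊗ₜ (b • y)) = g b • equiv (x ⊗ₜ y)

namespace BoxTensor

variable {f : P →ₐ[k] R} {g : Q →ₐ[k] R} {M N T : Type} [AddCommGroup M]
    [AddCommGroup N] [AddCommGroup T] [Module P M] [Module Q N] [Module R T]
    [Module k M] [Module k N] [Module k T]

/-- Interchange of the two factors. -/
def swap (E : BoxTensor f g M N T) : BoxTensor g f N M T where
  equiv := TensorProduct.comm k N M ≪≫ₗ E.equiv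
  left_smul b y x := by simp [E.right_smul]
  right_smul a y x := by simp [E.left_smul]

theorem equiv_rTensor_lsmul [IsScalarTower k P M] (E : BoxTensor f g M N T) (a : P)
    (w : M ⊗[k] N) : E.equiv (((LinearMap.lsmul P M a).restrictScalars k).rTensor N w) =
      f a • E.equiv w := by
  induction w with
  | zero => simp
  | tmul x y => simp [E.left_smul]
  | add u v hu hv => rw [map_add, map_add, hu, hv, map_add, smul_add]

theorem isSMulRegular [IsScalarTower k P M] (E : BoxTensor f g M N T) {a : P}
    (ha : IsSMulRegular M a) : IsSMulRegular T (f a) := by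
  have hinj := Module.Flat.rTensor_preserves_injective_linearMap (M := N)
    ((LinearMap.lsmul P M a).restrictScalars k) ha
  intro u v huv
  obtain ⟨u, rfl⟩ := E.equiv.surjective u
  obtain ⟨v, rfl⟩ := E.equiv.surjective v
  change f a • _ = f a • _ at huv
  rw [← equiv_rTensor_lsmul, ← equiv_rTensor_lsmul] at huv
  rw [hinj (E.equiv.injective huv)]

theorem exists_quotient [IsScalarTower k P M] [IsScalarTower k R T] (E : BoxTensor f g M N T)
    {a : P} {M' : Type} [AddCommGroup M'] [Module P M'] [Module k M'] [IsScalarTower k P M']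
    (π : M →ₗ[P] M') (hπ : Function.Surjective π)
    (hex : Function.Exact (LinearMap.lsmul P M a) π) :
    Nonempty (BoxTensor f g M' N (T ⧸ LinearMap.range (LinearMap.lsmul R T (f a)))) := by
  let p : T →ₗ[R] T ⧸ LinearMap.range (LinearMap.lsmul R T (f a)) := Submodule.mkQ _
  let π' := (π.restrictScalars k).rTensor N
  have hπ' : Function.Surjective π' := LinearMap.rTensor_surjective N hπ
  have hp : Function.Surjective p := Submodule.mkQ_surjective _
  have hex' : Function.Exact (((LinearMap.lsmul P M a).restrictScalars k).rTensor N) π' :=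
    rTensor_exact N hex hπ
  have hker : LinearMap.ker π' = LinearMap.ker (p.restrictScalars k ∘ₗ E.equiv.toLinearMap) := by
    ext w
    rw [LinearMap.mem_ker, hex' w]
    simp only [LinearMap.mem_ker, LinearMap.comp_apply, LinearMap.restrictScalars_apply, p,
      Submodule.mkQ_apply, Submodule.Quotient.mk_eq_zero, LinearMap.mem_range, Set.mem_range,
      LinearMap.lsmul_apply]
    constructor
    · rintro ⟨u, rfl⟩
      exact ⟨E.equiv u, (E.equiv_rTensor_lsmul a u).symm⟩
    · rintro ⟨v, hv⟩
      obtain ⟨u, rfl⟩ := E.equiv.surjective v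
      refine ⟨u, E.equiv.injective ?_⟩
      rw [E.equiv_rTensor_lsmul]
      exact hv
  let e : M' ⊗[k] N ≃ₗ[k] T ⧸ LinearMap.range (LinearMap.lsmul R T (f a)) :=
    (π'.quotKerEquivOfSurjective hπ').symm ≪≫ₗ Submodule.quotEquivOfEq _ _ hker ≪≫ₗ
      (p.restrictScalars k ∘ₗ E.equiv.toLinearMap).quotKerEquivOfSurjective
        (hp.comp E.equiv.surjective)
  have he (w : M ⊗[k] N) : e (π' w) = p (E.equiv w) := by
    have : (π'.quotKerEquivOfSurjective hπ').symm (π' w) = Submodule.Quotient.mk w := by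
      rw [LinearEquiv.symm_apply_eq]
      rfl
    simp only [e, LinearEquiv.trans_apply, this]
    rfl
  refine ⟨⟨e, ?_, ?_⟩⟩
  · intro b x y
    obtain ⟨x, rfl⟩ := hπ x
    have h1 := he ((b • x) ⊗ₜ y)
    have h2 := he (x ⊗ₜ y)
    simp only [π', LinearMap.rTensor_tmul, LinearMap.restrictScalars_apply, map_smul] at h1 h2
    rw [h1, h2, E.left_smul, map_smul]
  · intro b x y
    obtain ⟨x, rfl⟩ := hπ x
    have h1 := he (x ⊗ₜ (b • y))
    have h2 := he (x ⊗ₜ y)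
    simp only [π', LinearMap.rTensor_tmul, LinearMap.restrictScalars_apply] at h1 h2
    rw [h1, h2, E.right_smul, map_smul]

theorem hasDepth_add_one [IsScalarTower k P M] [IsScalarTower k R T] {mR : Ideal R}
    (E : BoxTensor f g M N T) {a : P} {M' : Type} [AddCommGroup M'] [Module P M']
    [Module k M'] [IsScalarTower k P M'] (π : M →ₗ[P] M') (hπ : Function.Surjective π)
    (hex : Function.Exact (LinearMap.lsmul P M a) π) (ha : IsSMulRegular M a) (hm : f a ∈ mR)
    {d : ℕ} (h : ∀ (T' : Type) [AddCommGroup T'] [Module R T'] [Module k T'] [IsScalarTower k R T'],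
      BoxTensor f g M' N T' → HasDepth mR d T') : HasDepth mR (d + 1) T := by
  obtain ⟨E'⟩ := E.exists_quotient π hπ hex
  exact .succ hm (E.isSMulRegular ha) _ (Submodule.mkQ_surjective _)
    (LinearMap.exact_map_mkQ_range _) (h _ E')

theorem hasDepth_of_socle [IsScalarTower k P M] {mP : Ideal P} {x : M} (hx : x ≠ 0)
    (hxm : ∀ a ∈ mP, a • x = 0) {mQ : Ideal Q} {b : ℕ} {N : Type}
    [AddCommGroup N] [Module Q N] (hN : HasDepth mQ b N) :
    ∀ [Module k N] [IsScalarTower k Q N] (T : Type) [AddCommGroup T] [Module R T] [Module k T]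
      [IsScalarTower k R T] (_ : BoxTensor f g M N T),
      HasDepth (mP.map f ⊔ mQ.map g) b T := by
  induction hN with
  | @zero N _ _ y hy hym =>
    intro _ _ T _ _ _ _ E
    refine .zero (z := E.equiv (x ⊗ₜ y)) ?_ ?_
    · rw [Ne, E.equiv.map_eq_zero_iff]
      intro h0
      obtain ⟨φ, hφ⟩ := not_forall.1 ((Module.forall_dual_apply_eq_zero_iff k x).not.2 hx)
      obtain ⟨ψ, hψ⟩ := not_forall.1 ((Module.forall_dual_apply_eq_zero_iff k y).not.2 hy)
      have := congrArg (fun w ↦ TensorProduct.lid k k (TensorProduct.map φ ψ w)) h0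
      simp [hφ, hψ] at this
    · have hle : mP.map f ⊔ mQ.map g ≤
          LinearMap.ker (LinearMap.toSpanSingleton R T (E.equiv (x ⊗ₜ y))) := by
        refine sup_le (Ideal.map_le_iff_le_comap.2 fun c hc ↦ ?_)
          (Ideal.map_le_iff_le_comap.2 fun c hc ↦ ?_)
        · change f c • E.equiv (x ⊗ₜ y) = 0
          rw [← E.left_smul, hxm c hc, zero_tmul, map_zero]
        · change g c • E.equiv (x ⊗ₜ y) = 0
          rw [← E.right_smul, hym c hc, tmul_zero, map_zero]
      exact fun c hc ↦ hle hc
  | @succ d N N' _ _ _ _ b hb hreg π hπ hex h ih =>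
    intro _ _ T _ _ _ _ E
    let _ : Module k N' := Module.compHom N' (algebraMap k Q)
    have : IsScalarTower k Q N' := .of_algebraMap_smul fun _ _ ↦ rfl
    exact E.swap.hasDepth_add_one π hπ hex hreg
      (Ideal.mem_sup_right (Ideal.mem_map_of_mem g hb)) fun T' _ _ _ _ E' ↦ ih T' E'.swap

end BoxTensor

theorem HasDepth.boxTensor {f : P →ₐ[k] R} {g : Q →ₐ[k] R} {mP : Ideal P} {mQ : Ideal Q}
    {a b : ℕ} {M N : Type} [AddCommGroup M] [AddCommGroup N] [Module P M] [Module Q N]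
    (hM : HasDepth mP a M) (hN : HasDepth mQ b N) :
    ∀ [Module k M] [IsScalarTower k P M] [Module k N] [IsScalarTower k Q N] (T : Type)
      [AddCommGroup T] [Module R T] [Module k T] [IsScalarTower k R T],
      BoxTensor f g M N T → HasDepth (mP.map f ⊔ mQ.map g) (a + b) T := by
  induction hM with
  | @zero M _ _ x hx hxm =>
    intro _ _ _ _ T _ _ _ _ E
    rw [zero_add]
    exact BoxTensor.hasDepth_of_socle hx hxm hN T E
  | @succ d M M' _ _ _ _ a ha hreg π hπ hex h ih =>
    intro _ _ _ _ T _ _ _ _ E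
    let _ : Module k M' := Module.compHom M' (algebraMap k P)
    have : IsScalarTower k P M' := .of_algebraMap_smul fun _ _ ↦ rfl
    rw [add_right_comm]
    exact E.hasDepth_add_one π hπ hex hreg
      (Ideal.mem_sup_left (Ideal.mem_map_of_mem f ha)) fun T' _ _ _ _ E' ↦ ih T' E'

end Tensor

/-- The subquotient `p ⧸ q` attached to two ideals. -/
abbrev Subquotient {A : Type} [CommRing A] (p q : Ideal A) : Type :=
  ↥p ⧸ Submodule.comap p.subtype q

/-- The image of the ideal `c` in the subquotient `p ⧸ q`. -/
def subquotientImage {A : Type} [CommRing A] (p q c : Ideal A) : Submodule A (Subquotient p q) :=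
  (Submodule.comap p.subtype c).map (Submodule.mkQ _)

theorem subquotient_mapQ_injective {A : Type} [CommRing A] (p q : Ideal A) :
    Function.Injective (Submodule.mapQ (Submodule.comap p.subtype q) q p.subtype le_rfl) := by
  refine (injective_iff_map_eq_zero _).2 fun x hx ↦ ?_
  obtain ⟨x, rfl⟩ := Submodule.mkQ_surjective _ x
  exact (Submodule.Quotient.mk_eq_zero _).2 ((Submodule.Quotient.mk_eq_zero q).1 hx)

section ProductIdeals

open TensorProduct

variable {k A B C : Type} [Field k] [CommRing A] [CommRing B] [CommRing C] [Algebra k A]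
  [Algebra k B] [Algebra k C] (μ : A ⊗[k] B ≃ₐ[k] C) (f : A →ₐ[k] C) (g : B →ₐ[k] C)
  (hf : ∀ x, f x = μ (x ⊗ₜ 1)) (hg : ∀ y, g y = μ (1 ⊗ₜ y))

/-- The multiplication map `a ⊗ b → C` for ideals `a` of `A` and `b` of `B`. -/
def idealTensorMap (a : Ideal A) (b : Ideal B) : a ⊗[k] b →ₗ[k] C :=
  μ.toLinearMap ∘ₗ TensorProduct.map (a.subtype.restrictScalars k) (b.subtype.restrictScalars k)

/-- The projection from `a ⊗ b` to the tensor product of two subquotients. -/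
def idealTensorProj (a a' : Ideal A) (b b' : Ideal B) :
    a ⊗[k] b →ₗ[k] Subquotient a a' ⊗[k] Subquotient b b' :=
  TensorProduct.map ((Submodule.mkQ (Submodule.comap a.subtype a')).restrictScalars k)
    ((Submodule.mkQ (Submodule.comap b.subtype b')).restrictScalars k)

variable {μ f g}

include hf hg in
theorem idealTensorMap_tmul (a : Ideal A) (b : Ideal B) (x : a) (y : b) :
    idealTensorMap μ a b (x ⊗ₜ y) = f x * g y := by
  rw [hf, hg, ← map_mul]
  simp [idealTensorMap]

theorem idealTensorProj_tmul (a a' : Ideal A) (b b' : Ideal B) (x : a) (y : b) :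
    idealTensorProj (k := k) a a' b b' (x ⊗ₜ y) =
      (Submodule.mkQ (Submodule.comap a.subtype a') x) ⊗ₜ
        (Submodule.mkQ (Submodule.comap b.subtype b') y) :=
  rfl

theorem idealTensorProj_surjective (a a' : Ideal A) (b b' : Ideal B) :
    Function.Surjective (idealTensorProj (k := k) a a' b b') := by
  intro w
  induction w with
  | zero => exact ⟨0, map_zero _⟩
  | add u v hu hv =>
    obtain ⟨u, rfl⟩ := hu
    obtain ⟨v, rfl⟩ := hv
    exact ⟨u + v, map_add _ _ _⟩
  | tmul x y =>
    obtain ⟨x, rfl⟩ := Submodule.mkQ_surjective _ x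
    obtain ⟨y, rfl⟩ := Submodule.mkQ_surjective _ y
    exact ⟨x ⊗ₜ y, idealTensorProj_tmul a a' b b' x y⟩

include hf hg in
theorem idealTensorMap_mem (a : Ideal A) (b : Ideal B) (w : a ⊗[k] b) :
    idealTensorMap μ a b w ∈ a.map f * b.map g := by
  induction w with
  | zero => simp
  | tmul x y =>
    rw [idealTensorMap_tmul hf hg]
    exact Ideal.mul_mem_mul (Ideal.mem_map_of_mem f x.2) (Ideal.mem_map_of_mem g y.2)
  | add u v hu hv => rw [map_add]; exact add_mem hu hv

include hf hg in
theorem exists_idealTensorMap_eq {a : Ideal A} {b : Ideal B} {c : C}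
    (hc : c ∈ a.map f * b.map g) : ∃ w, idealTensorMap μ a b w = c := by
  rw [Ideal.map, Ideal.map, Ideal.span_mul_span'] at hc
  induction hc using Submodule.span_induction with
  | mem c hc =>
    obtain ⟨_, ⟨x, hx, rfl⟩, _, ⟨y, hy, rfl⟩, rfl⟩ := hc
    exact ⟨⟨x, hx⟩ ⊗ₜ ⟨y, hy⟩, idealTensorMap_tmul hf hg _ _ _ _⟩
  | zero => exact ⟨0, map_zero _⟩
  | add c d _ _ hc hd =>
    obtain ⟨u, rfl⟩ := hc
    obtain ⟨v, rfl⟩ := hd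
    exact ⟨u + v, map_add _ _ _⟩
  | smul t c hmem hc =>
    obtain ⟨w, rfl⟩ := hc
    clear hmem
    obtain ⟨t, rfl⟩ := μ.surjective t
    induction t with
    | zero => exact ⟨0, by simp⟩
    | add t₁ t₂ h₁ h₂ =>
      obtain ⟨w₁, h₁⟩ := h₁
      obtain ⟨w₂, h₂⟩ := h₂
      exact ⟨w₁ + w₂, by rw [map_add, map_add, add_smul, h₁, h₂]⟩
    | tmul x y =>
      refine ⟨TensorProduct.map ((LinearMap.lsmul A a x).restrictScalars k)
        ((LinearMap.lsmul B b y).restrictScalars k) w, ?_⟩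
      have hxy : μ (x ⊗ₜ y) = f x * g y := by
        rw [hf, hg, ← map_mul]
        simp
      rw [hxy]
      induction w with
      | zero => simp
      | add u v hu hv => rw [map_add, map_add, map_add, smul_add, hu, hv]
      | tmul p q =>
        simp only [TensorProduct.map_tmul, LinearMap.restrictScalars_apply, LinearMap.lsmul_apply,
          idealTensorMap_tmul hf hg, Submodule.coe_smul, smul_eq_mul, map_mul]
        ring

omit [Algebra k C] in
theorem map_mem_of_tensorMap_eq_zero {M' M M'' N' N N'' : Type} [AddCommGroup M'] [AddCommGroup M]
    [AddCommGroup M''] [AddCommGroup N'] [AddCommGroup N] [AddCommGroup N''] [Module k M']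
    [Module k M] [Module k M''] [Module k N'] [Module k N] [Module k N''] {i : M' →ₗ[k] M}
    {p : M →ₗ[k] M''} {i' : N' →ₗ[k] N} {p' : N →ₗ[k] N''} (h : Function.Exact i p)
    (h' : Function.Exact i' p') (hp : Function.Surjective p) (hp' : Function.Surjective p')
    (φ : M ⊗[k] N →+ C) (S : Ideal C) (hl : ∀ x y, φ (i x ⊗ₜ y) ∈ S)
    (hr : ∀ x y, φ (x ⊗ₜ i' y) ∈ S) {w : M ⊗[k] N} (hw : TensorProduct.map p p' w = 0) :
    φ w ∈ S := by
  have hmem : w ∈ LinearMap.ker (TensorProduct.map p p') := hw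
  rw [TensorProduct.map_ker h hp h' hp'] at hmem
  obtain ⟨_, ⟨u, rfl⟩, _, ⟨v, rfl⟩, rfl⟩ := Submodule.mem_sup.1 hmem
  clear hw hmem
  rw [map_add]
  refine add_mem ?_ ?_
  · induction u with
    | zero => simp
    | add p q hp hq => simpa only [map_add] using add_mem hp hq
    | tmul x y => exact hr x y
  · induction v with
    | zero => simp
    | add p q hp hq => simpa only [map_add] using add_mem hp hq
    | tmul x y => exact hl x y

include hf hg in
theorem idealTensorMap_mem_of_proj_eq_zero {a a' : Ideal A} {b b' : Ideal B} {w : a ⊗[k] b}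
    (hw : idealTensorProj a a' b b' w = 0) :
    idealTensorMap μ a b w ∈ a'.map f * b.map g ⊔ a.map f * b'.map g := by
  refine map_mem_of_tensorMap_eq_zero
    (i := (Submodule.comap a.subtype a').subtype.restrictScalars k)
    (i' := (Submodule.comap b.subtype b').subtype.restrictScalars k)
    (p := (Submodule.comap a.subtype a').mkQ.restrictScalars k)
    (p' := (Submodule.comap b.subtype b').mkQ.restrictScalars k)
    (LinearMap.exact_subtype_mkQ (Submodule.comap a.subtype a'))
    (LinearMap.exact_subtype_mkQ (Submodule.comap b.subtype b'))
    (Submodule.mkQ_surjective (Submodule.comap a.subtype a'))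
    (Submodule.mkQ_surjective (Submodule.comap b.subtype b'))
    (idealTensorMap μ a b).toAddMonoidHom _ (fun x y ↦ ?_) (fun x y ↦ ?_) hw
  · change idealTensorMap μ a b (x.1 ⊗ₜ y) ∈ _
    rw [idealTensorMap_tmul hf hg]
    exact Ideal.mem_sup_left
      (Ideal.mul_mem_mul (Ideal.mem_map_of_mem f x.2) (Ideal.mem_map_of_mem g y.2))
  · change idealTensorMap μ a b (x ⊗ₜ y.1) ∈ _
    rw [idealTensorMap_tmul hf hg]
    exact Ideal.mem_sup_right
      (Ideal.mul_mem_mul (Ideal.mem_map_of_mem f x.2) (Ideal.mem_map_of_mem g y.2))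

include hf hg in
theorem proj_eq_zero_of_idealTensorMap_mem {a a' : Ideal A} {b b' : Ideal B} {w : a ⊗[k] b}
    (hw : idealTensorMap μ a b w ∈ a'.map f ⊔ b'.map g) : idealTensorProj a a' b b' w = 0 := by
  let ψ : C →ₐ[k] (A ⧸ a') ⊗[k] (B ⧸ b') :=
    (Algebra.TensorProduct.map (Ideal.Quotient.mkₐ k a') (Ideal.Quotient.mkₐ k b')).comp
      μ.symm.toAlgHom
  have hψf (x : A) : ψ (f x) = Ideal.Quotient.mk a' x ⊗ₜ 1 := by
    simp [ψ, hf]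
  have hψg (y : B) : ψ (g y) = 1 ⊗ₜ Ideal.Quotient.mk b' y := by
    simp [ψ, hg]
  have hle : a'.map f ⊔ b'.map g ≤ RingHom.ker ψ := by
    refine sup_le (Ideal.map_le_iff_le_comap.2 fun x hx ↦ ?_)
      (Ideal.map_le_iff_le_comap.2 fun y hy ↦ ?_)
    · change ψ (f x) = 0
      rw [hψf, Ideal.Quotient.eq_zero_iff_mem.2 hx, zero_tmul]
    · change ψ (g y) = 0
      rw [hψg, Ideal.Quotient.eq_zero_iff_mem.2 hy, tmul_zero]
  let ia : Subquotient a a' →ₗ[k] A ⧸ a' :=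
    (Submodule.mapQ (Submodule.comap a.subtype a') a' a.subtype le_rfl).restrictScalars k
  let ib : Subquotient b b' →ₗ[k] B ⧸ b' :=
    (Submodule.mapQ (Submodule.comap b.subtype b') b' b.subtype le_rfl).restrictScalars k
  have hia : Function.Injective ia := subquotient_mapQ_injective a a'
  have hib : Function.Injective ib := subquotient_mapQ_injective b b'
  have hcomp (w : a ⊗[k] b) : ψ (idealTensorMap μ a b w) =
      TensorProduct.map ia ib (idealTensorProj a a' b b' w) := by
    induction w with
    | zero => simp
    | add u v hu hv => rw [map_add, map_add, map_add, map_add, hu, hv]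
    | tmul x y =>
      rw [idealTensorMap_tmul hf hg, map_mul, hψf, hψg, Algebra.TensorProduct.tmul_mul_tmul,
        mul_one, one_mul]
      rfl
  apply TensorProduct.map_injective_of_flat_flat ia ib hia hib
  rw [← hcomp, map_zero]
  exact hle hw

include hf hg in
/-- The part of `ab` inside the sum of two smaller ideals comes from the smaller ideals
factorwise. -/
theorem mul_inf_sup_le {a a' : Ideal A} {b b' : Ideal B} {q : Ideal C}
    (hq : a'.map f * b.map g ⊔ a.map f * b'.map g ≤ q) :
    (a.map f * b.map g) ⊓ (a'.map f ⊔ b'.map g) ≤ q := by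
  rintro c ⟨hc, hc'⟩
  obtain ⟨w, rfl⟩ := exists_idealTensorMap_eq hf hg hc
  exact hq (idealTensorMap_mem_of_proj_eq_zero hf hg
    (proj_eq_zero_of_idealTensorMap_mem hf hg hc'))

include hf hg in
theorem nonempty_boxTensor_subquotientImage {a a' : Ideal A} {b b' : Ideal B} {p q : Ideal C}
    (hp : a.map f * b.map g ≤ p) (hq : a'.map f * b.map g ⊔ a.map f * b'.map g ≤ q)
    (hq' : q ≤ a'.map f ⊔ b'.map g) :
    Nonempty (BoxTensor f g (Subquotient a a') (Subquotient b b')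
      (subquotientImage p q (a.map f * b.map g))) := by
  let φ : a ⊗[k] b →ₗ[k] subquotientImage p q (a.map f * b.map g) :=
    { toFun w := ⟨Submodule.Quotient.mk ⟨idealTensorMap μ a b w,
          hp (idealTensorMap_mem hf hg a b w)⟩,
        ⟨⟨_, hp (idealTensorMap_mem hf hg a b w)⟩, idealTensorMap_mem hf hg a b w, rfl⟩⟩
      map_add' u v := by
        ext
        simp only [map_add]
        rfl
      map_smul' t u := by
        ext
        simp only [map_smul]
        rfl }
  have hφ0 (w) : φ w = 0 ↔ idealTensorMap μ a b w ∈ q := by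
    rw [Subtype.ext_iff]
    exact Submodule.Quotient.mk_eq_zero _
  have hφ : Function.Surjective φ := by
    rintro ⟨_, ⟨⟨c, hcp⟩, hc, rfl⟩⟩
    obtain ⟨w, rfl⟩ := exists_idealTensorMap_eq hf hg (hc : c ∈ _)
    exact ⟨w, rfl⟩
  have hker : LinearMap.ker (idealTensorProj (k := k) a a' b b') = LinearMap.ker φ := by
    ext w
    rw [LinearMap.mem_ker, LinearMap.mem_ker, hφ0]
    exact ⟨fun h ↦ hq (idealTensorMap_mem_of_proj_eq_zero hf hg h),
      fun h ↦ proj_eq_zero_of_idealTensorMap_mem hf hg (hq' h)⟩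
  let e := ((idealTensorProj (k := k) a a' b b').quotKerEquivOfSurjective
      (idealTensorProj_surjective a a' b b')).symm ≪≫ₗ Submodule.quotEquivOfEq _ _ hker ≪≫ₗ
    φ.quotKerEquivOfSurjective hφ
  have he (x : a) (y : b) :
      e (Submodule.Quotient.mk x ⊗ₜ Submodule.Quotient.mk y) = φ (x ⊗ₜ y) := by
    have : ((idealTensorProj (k := k) a a' b b').quotKerEquivOfSurjective
        (idealTensorProj_surjective a a' b b')).symm
          (Submodule.Quotient.mk x ⊗ₜ Submodule.Quotient.mk y) =
        Submodule.Quotient.mk (x ⊗ₜ y) := by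
      rw [LinearEquiv.symm_apply_eq]
      rfl
    simp only [e, LinearEquiv.trans_apply, this]
    rfl
  refine ⟨⟨e, fun (s : A) x y ↦ ?_, fun (s : B) x y ↦ ?_⟩⟩
  · obtain ⟨x, rfl⟩ := Submodule.mkQ_surjective _ x
    obtain ⟨y, rfl⟩ := Submodule.mkQ_surjective _ y
    refine (he ((s : A) • x) y).trans (Eq.trans ?_ (congrArg (f s • ·) (he x y).symm))
    ext
    refine congrArg Submodule.Quotient.mk (Subtype.ext ?_)
    change idealTensorMap μ a b _ = f s * idealTensorMap μ a b _
    rw [idealTensorMap_tmul hf hg, idealTensorMap_tmul hf hg, ← mul_assoc, ← map_mul]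
    rfl
  · obtain ⟨x, rfl⟩ := Submodule.mkQ_surjective _ x
    obtain ⟨y, rfl⟩ := Submodule.mkQ_surjective _ y
    refine (he x ((s : B) • y)).trans (Eq.trans ?_ (congrArg (g s • ·) (he x y).symm))
    ext
    refine congrArg Submodule.Quotient.mk (Subtype.ext ?_)
    change idealTensorMap μ a b _ = g s * idealTensorMap μ a b _
    rw [idealTensorMap_tmul hf hg, idealTensorMap_tmul hf hg, mul_left_comm, ← map_mul]
    rfl

include hf hg in
theorem HasDepth.subquotientImage {mA : Ideal A} {mB : Ideal B} {d e : ℕ} {a a' : Ideal A}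
    {b b' : Ideal B} {p q : Ideal C} (hd : HasDepth mA d (Subquotient a a'))
    (he : HasDepth mB e (Subquotient b b'))
    (hp : a.map f * b.map g ≤ p) (hq : a'.map f * b.map g ⊔ a.map f * b'.map g ≤ q)
    (hq' : q ≤ a'.map f ⊔ b'.map g) :
    HasDepth (mA.map f ⊔ mB.map g) (d + e) (subquotientImage p q (a.map f * b.map g)) := by
  obtain ⟨E⟩ := nonempty_boxTensor_subquotientImage hf hg hp hq hq'
  exact hd.boxTensor he _ E

end ProductIdeals

section Powers

variable {C : Type} [CommRing C] (I J : Ideal C)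

theorem sup_pow_le_iSup (n : ℕ) :
    (I ⊔ J) ^ n ≤ ⨆ l : Fin (n + 1), I ^ (l : ℕ) * J ^ (n - l) := by
  rw [← Ideal.add_eq_sup, add_pow, Ideal.sum_eq_sup]
  refine Finset.sup_le fun l hl ↦ Ideal.mul_le_left.trans ?_
  exact le_iSup (fun l : Fin (n + 1) ↦ I ^ (l : ℕ) * J ^ (n - l)) ⟨l, Finset.mem_range.1 hl⟩

theorem pow_mul_pow_le_sup_pow {a b n : ℕ} (h : n ≤ a + b) : I ^ a * J ^ b ≤ (I ⊔ J) ^ n :=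
  calc I ^ a * J ^ b ≤ (I ⊔ J) ^ a * (I ⊔ J) ^ b :=
        Ideal.mul_mono (Ideal.pow_right_mono le_sup_left a) (Ideal.pow_right_mono le_sup_right b)
    _ = (I ⊔ J) ^ (a + b) := (pow_add _ _ _).symm
    _ ≤ (I ⊔ J) ^ n := Ideal.pow_le_pow_right h

theorem sup_pow_le_pow_sup_pow {a b n : ℕ} (h : a + b ≤ n + 1) :
    (I ⊔ J) ^ n ≤ I ^ a ⊔ J ^ b := by
  refine (sup_pow_le_iSup I J n).trans (iSup_le fun l ↦ ?_)
  obtain hl | hl : a ≤ l ∨ b ≤ n - l := by omega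
  · exact Ideal.mul_le_left.trans ((Ideal.pow_le_pow_right hl).trans le_sup_left)
  · exact Ideal.mul_le_right.trans ((Ideal.pow_le_pow_right hl).trans le_sup_right)

theorem isInternal_subquotientImage (n : ℕ)
    (h : ∀ l ≤ n, (I ^ l * J ^ (n - l)) ⊓ (I ^ (l + 1) ⊔ J ^ (n - l + 1)) ≤ (I ⊔ J) ^ (n + 1)) :
    DirectSum.IsInternal fun l : Fin (n + 1) ↦
      subquotientImage ((I ⊔ J) ^ n) ((I ⊔ J) ^ (n + 1)) (I ^ (l : ℕ) * J ^ (n - l)) := by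
  refine DirectSum.isInternal_submodule_iff_iSupIndep_and_iSup_eq_top _ |>.2 ⟨fun l ↦ ?_, ?_⟩
  · have hle : ⨆ j, ⨆ (_ : j ≠ l), subquotientImage ((I ⊔ J) ^ n) ((I ⊔ J) ^ (n + 1))
        (I ^ (j : ℕ) * J ^ (n - j)) ≤ subquotientImage ((I ⊔ J) ^ n) ((I ⊔ J) ^ (n + 1))
          (I ^ (l + 1 : ℕ) ⊔ J ^ (n - l + 1)) := by
      refine iSup₂_le fun j hj ↦ Submodule.map_mono (Submodule.comap_mono ?_)
      obtain hj | hj : (l + 1 : ℕ) ≤ j ∨ n - l + 1 ≤ n - j := by omega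
      · exact Ideal.mul_le_left.trans ((Ideal.pow_le_pow_right hj).trans le_sup_left)
      · exact Ideal.mul_le_right.trans ((Ideal.pow_le_pow_right hj).trans le_sup_right)
    refine Disjoint.mono_right hle (Submodule.disjoint_def.2 ?_)
    rintro _ ⟨x, hx, rfl⟩ ⟨y, hy, hxy⟩
    refine (Submodule.Quotient.mk_eq_zero _).2 (h l (by omega) ⟨hx, ?_⟩)
    have hsub : ((y - x : ↥((I ⊔ J) ^ n)) : C) ∈ (I ⊔ J) ^ (n + 1) := (Submodule.Quotient.eq
      (Submodule.comap ((I ⊔ J) ^ n).subtype ((I ⊔ J) ^ (n + 1)))).1 hxy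
    have hK := sup_pow_le_pow_sup_pow I J (a := l + 1) (b := n - l + 1) (by omega) hsub
    have hy : (y : C) ∈ I ^ (l + 1 : ℕ) ⊔ J ^ (n - l + 1) := hy
    have := sub_mem hy hK
    simpa using this
  · refine eq_top_iff.2 fun x _ ↦ ?_
    obtain ⟨⟨x, hx⟩, rfl⟩ := Submodule.mkQ_surjective _ x
    obtain ⟨y, rfl, hy⟩ := Submodule.iSup_induction _ (motive := fun x ↦ ∃ y : ↥((I ⊔ J) ^ n),
      (y : C) = x ∧ (Submodule.comap ((I ⊔ J) ^ n).subtype ((I ⊔ J) ^ (n + 1))).mkQ y ∈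
        ⨆ l : Fin (n + 1), subquotientImage ((I ⊔ J) ^ n) ((I ⊔ J) ^ (n + 1))
          (I ^ (l : ℕ) * J ^ (n - l)))
      (sup_pow_le_iSup I J n hx)
      (fun l x hx ↦ ⟨⟨x, pow_mul_pow_le_sup_pow I J (by omega) hx⟩, rfl,
        Submodule.mem_iSup_of_mem l ⟨_, hx, rfl⟩⟩)
      ⟨0, rfl, by rw [map_zero]; exact zero_mem _⟩
      (by
        rintro _ _ ⟨x, rfl, hx⟩ ⟨y, rfl, hy⟩
        exact ⟨x + y, rfl, by rw [map_add]; exact add_mem hx hy⟩)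
    exact hy

end Powers

section Retractions

variable {ι Q : Type} [Fintype ι] [DecidableEq ι] [AddCommGroup Q] [Module R Q]

theorem exists_retractions {A : ι → Submodule R Q} (h : DirectSum.IsInternal A) :
    ∃ p : ∀ l, Q →ₗ[R] A l, ∑ l, (A l).subtype ∘ₗ p l = LinearMap.id ∧
      ∀ l, p l ∘ₗ (A l).subtype = LinearMap.id := by
  let e := LinearEquiv.ofBijective (DirectSum.coeLinearMap A) h
  have he (l : ι) (x : A l) : e.symm x = DirectSum.lof R ι (fun l ↦ A l) l x := by
    rw [LinearEquiv.symm_apply_eq]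
    exact (DirectSum.coeLinearMap_lof A l x).symm
  refine ⟨fun l ↦ DirectSum.component R ι (fun l ↦ A l) l ∘ₗ e.symm.toLinearMap, ?_, fun l ↦ ?_⟩
  · ext x
    have hx : x ∈ ⨆ l, A l := by
      rw [h.submodule_iSup_eq_top]
      trivial
    refine Submodule.iSup_induction A (motive := fun x ↦
      (∑ l, (A l).subtype ∘ₗ DirectSum.component R ι (fun l ↦ A l) l ∘ₗ e.symm.toLinearMap) x =
        LinearMap.id x) hx (fun l x hx ↦ ?_) (by simp)
      (fun x y hx hy ↦ by rw [map_add, map_add, hx, hy])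
    · lift x to A l using hx
      simp only [LinearMap.coe_sum, Finset.sum_apply, LinearMap.comp_apply, LinearEquiv.coe_coe,
        LinearMap.id_apply, he]
      rw [Finset.sum_eq_single l]
      · simp
      · intro j _ hj
        rw [DirectSum.component.of, dif_neg hj.symm, map_zero]
      · simp
  · ext x
    simp [he]

theorem hasSurvivingExt_of_isInternal {m : Ideal R} {i : ℕ} {A : ι → Submodule R Q}
    (h : DirectSum.IsInternal A) : HasSurvivingExt m i (ModuleCat.of R Q) ↔
      ∃ l, HasSurvivingExt m i (ModuleCat.of R (A l)) := by
  obtain ⟨p, hp, hp'⟩ := exists_retractions h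
  constructor
  · refine HasSurvivingExt.of_comp_ne (fun l ↦ ModuleCat.ofHom (p l))
      (fun l ↦ ModuleCat.ofHom (A l).subtype) ?_
    apply ModuleCat.hom_ext
    rw [ModuleCat.hom_sum]
    exact hp
  · rintro ⟨l, hl⟩
    refine hl.of_retract (ModuleCat.ofHom (A l).subtype) (ModuleCat.ofHom (p l)) ?_
    rw [← ModuleCat.ofHom_comp, hp']
    rfl

end Retractions

open PaperHTT TensorProduct

section Depth

variable {k : Type} [Field k] {σ τ : Type}

theorem depthM_eq {M : ModuleCat (MvPolynomial σ k)} {d : ℕ}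
    (h : HasSurvivingExt (maxHomIdeal k σ) d M)
    (h' : ∀ i < d, ¬ HasSurvivingExt (maxHomIdeal k σ) i M) : depthM k M = d := by
  refine IsLeast.csInf_eq ⟨(nontrivial_localCohomology_iff _ _ _).2 h, fun i hi ↦ ?_⟩
  by_contra! hid
  exact h' i hid ((nontrivial_localCohomology_iff _ _ _).1 hi)

theorem maxHomIdeal_ne_top : maxHomIdeal k σ ≠ ⊤ := by
  have hle : maxHomIdeal k σ ≤ RingHom.ker (MvPolynomial.constantCoeff (R := k) (σ := σ)) := by
    refine Ideal.span_le.2 ?_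
    rintro _ ⟨i, rfl⟩
    exact MvPolynomial.constantCoeff_X (R := k) i
  exact fun h ↦ RingHom.ker_ne_top (MvPolynomial.constantCoeff (R := k) (σ := σ))
    (top_le_iff.1 (h ▸ hle))

theorem le_maxHomIdeal {I : Ideal (MvPolynomial σ k)} (hI : I ≠ ⊤) (hIh : IsHomogeneousIdeal k I) :
    I ≤ maxHomIdeal k σ := by
  intro f hf
  have h0 : MvPolynomial.C (MvPolynomial.coeff 0 f) ∈ I := by
    simpa using hIh f hf 0
  have h0 : MvPolynomial.coeff 0 f = 0 := by
    by_contra h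
    exact hI (Ideal.eq_top_of_isUnit_mem _ h0 ((IsUnit.mk0 _ h).map MvPolynomial.C))
  rw [maxHomIdeal, ← Set.image_univ, MvPolynomial.mem_ideal_span_X_image]
  intro m hm
  by_contra! hm'
  have : m = 0 := Finsupp.ext fun i ↦ hm' i trivial
  exact MvPolynomial.mem_support_iff.1 hm (this ▸ h0)

theorem maxHomIdeal_sum :
    maxHomIdeal k (σ ⊕ τ) = (maxHomIdeal k σ).map (MvPolynomial.rename (R := k) Sum.inl) ⊔
      (maxHomIdeal k τ).map (MvPolynomial.rename (R := k) Sum.inr) := by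
  simp only [maxHomIdeal, Ideal.map_span, ← Ideal.span_union, ← Set.range_comp]
  congr 1
  ext f
  simp [Set.mem_range]

theorem smul_top_ne_top [Finite σ] {I : Ideal (MvPolynomial σ k)} (hI0 : I ≠ ⊥) (hI : I ≠ ⊤)
    (hIh : IsHomogeneousIdeal k I) (n : ℕ) :
    maxHomIdeal k σ • (⊤ : Submodule (MvPolynomial σ k) (Subquotient (I ^ n) (I ^ (n + 1)))) ≠
      ⊤ := by
  intro h
  have hle : I ^ n ≤ maxHomIdeal k σ • I ^ n := by
    intro x hx
    have hmem : (Submodule.comap (I ^ n).subtype (I ^ (n + 1))).mkQ ⟨x, hx⟩ ∈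
        maxHomIdeal k σ •
          (⊤ : Submodule (MvPolynomial σ k) (Subquotient (I ^ n) (I ^ (n + 1)))) := by
      rw [h]
      trivial
    rw [← Submodule.range_mkQ (Submodule.comap (I ^ n).subtype (I ^ (n + 1))), ← Submodule.map_top,
      ← Submodule.map_smul''] at hmem
    obtain ⟨y, hy, hxy⟩ := hmem
    have hy' : (y : MvPolynomial σ k) ∈ maxHomIdeal k σ • I ^ n := by
      have := Submodule.mem_map_of_mem (f := (I ^ n).subtype) hy
      rwa [Submodule.map_smul'', Submodule.map_top, Submodule.range_subtype] at this
    have hsub : ((y - ⟨x, hx⟩ : ↥(I ^ n)) : MvPolynomial σ k) ∈ I ^ (n + 1) :=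
      (Submodule.Quotient.eq (Submodule.comap (I ^ n).subtype (I ^ (n + 1)))).1 hxy
    have hsub' : (y : MvPolynomial σ k) - x ∈ maxHomIdeal k σ • I ^ n := by
      rw [pow_succ'] at hsub
      exact Ideal.mul_mono_left (le_maxHomIdeal hI hIh) hsub
    simpa using sub_mem hy' hsub'
  obtain ⟨c, hc, hc'⟩ := Submodule.exists_sub_one_mem_and_smul_eq_zero_of_fg_of_le_smul _ _
    (IsNoetherian.noetherian _) hle
  obtain ⟨x, hx, hx0⟩ := Submodule.exists_mem_ne_zero_of_ne_bot (pow_ne_zero n hI0)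
  obtain rfl := (mul_eq_zero.1 (hc' x hx)).resolve_right hx0
  refine maxHomIdeal_ne_top ((Ideal.eq_top_iff_one (maxHomIdeal k σ)).2 ?_)
  simpa using hc

theorem hasDepth_depthSubQuot [Finite σ] {I : Ideal (MvPolynomial σ k)} (hI0 : I ≠ ⊥) (hI : I ≠ ⊤)
    (hIh : IsHomogeneousIdeal k I) (n : ℕ) :
    HasDepth (maxHomIdeal k σ) (depthSubQuot k (I ^ n) (I ^ (n + 1)))
      (Subquotient (I ^ n) (I ^ (n + 1))) := by
  obtain ⟨d, hd⟩ := exists_hasDepth (smul_top_ne_top hI0 hI hIh n)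
  have : depthSubQuot k (I ^ n) (I ^ (n + 1)) = d :=
    depthM_eq hd.hasSurvivingExt.1 hd.hasSurvivingExt.2
  rwa [this]

variable {r s : ℕ}

theorem isLeast_depthSubQuot_sumIJ {I : Ideal (PA k r)} {J : Ideal (PB k s)} (hI0 : I ≠ ⊥)
    (hI : I ≠ ⊤) (hIh : IsHomogeneousIdeal k I) (hJ0 : J ≠ ⊥) (hJ : J ≠ ⊤)
    (hJh : IsHomogeneousIdeal k J) (n : ℕ) :
    IsLeast {v | ∃ i j, i + j = n ∧ v = depthSubQuot k (I ^ i) (I ^ (i + 1)) +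
      depthSubQuot k (J ^ j) (J ^ (j + 1))}
      (depthSubQuot k (sumIJ k I J ^ n) (sumIJ k I J ^ (n + 1))) := by
  let μ := MvPolynomial.tensorEquivSum k (Fin r) (Fin s) k
  let f : PA k r →ₐ[k] PR k r s := MvPolynomial.rename Sum.inl
  let g : PB k s →ₐ[k] PR k r s := MvPolynomial.rename Sum.inr
  have hf : ∀ x, f x = μ (x ⊗ₜ 1) := by
    refine DFunLike.congr_fun (?_ : f =
      μ.toAlgHom.comp Algebra.TensorProduct.includeLeft)
    ext i
    simp [f, μ]
  have hg : ∀ y, g y = μ (1 ⊗ₜ y) := by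
    refine DFunLike.congr_fun (?_ : g =
      μ.toAlgHom.comp Algebra.TensorProduct.includeRight)
    ext i
    simp [g, μ]
  have hle {l m : ℕ} (h : n ≤ l + m) :
      (I ^ l).map f * (J ^ m).map g ≤ sumIJ k I J ^ n := by
    rw [Ideal.map_pow, Ideal.map_pow]
    exact pow_mul_pow_le_sup_pow _ _ h
  have hle' {l m : ℕ} (h : l + m = n) :
      (I ^ (l + 1)).map f * (J ^ m).map g ⊔ (I ^ l).map f * (J ^ (m + 1)).map g ≤
        sumIJ k I J ^ (n + 1) := by
    simp only [Ideal.map_pow]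
    exact sup_le (pow_mul_pow_le_sup_pow _ _ (by omega)) (pow_mul_pow_le_sup_pow _ _ (by omega))
  have hle'' {l m : ℕ} (h : l + m = n) :
      sumIJ k I J ^ (n + 1) ≤ (I ^ (l + 1)).map f ⊔ (J ^ (m + 1)).map g := by
    simp only [Ideal.map_pow]
    exact sup_pow_le_pow_sup_pow _ _ (by omega)
  have hQ := isInternal_subquotientImage (I.map f) (J.map g) n fun l hl ↦ by
    have := mul_inf_sup_le hf hg (hle' (l := l) (m := n - l) (by omega))
    simp only [Ideal.map_pow] at this
    exact this
  have hdepth (l : Fin (n + 1)) : HasDepth (maxHomIdeal k (Fin r ⊕ Fin s))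
      (depthSubQuot k (I ^ (l : ℕ)) (I ^ (l + 1 : ℕ)) +
        depthSubQuot k (J ^ (n - l)) (J ^ (n - l + 1)))
      (subquotientImage ((I.map f ⊔ J.map g) ^ n) ((I.map f ⊔ J.map g) ^ (n + 1))
        (I.map f ^ (l : ℕ) * J.map g ^ (n - l))) := by
    rw [← Ideal.map_pow, ← Ideal.map_pow, maxHomIdeal_sum]
    exact (hasDepth_depthSubQuot hI0 hI hIh l).subquotientImage hf hg
      (hasDepth_depthSubQuot hJ0 hJ hJh (n - l)) (hle (by omega)) (hle' (by omega))
      (hle'' (by omega))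
  set v : Fin (n + 1) → ℕ := fun l ↦ depthSubQuot k (I ^ (l : ℕ)) (I ^ (l + 1 : ℕ)) +
    depthSubQuot k (J ^ (n - l)) (J ^ (n - l + 1)) with hv
  obtain ⟨l₀, hl₀⟩ := Finite.exists_min v
  have hS : depthSubQuot k (sumIJ k I J ^ n) (sumIJ k I J ^ (n + 1)) = v l₀ := by
    refine depthM_eq ((hasSurvivingExt_of_isInternal hQ).2
      ⟨l₀, (hdepth l₀).hasSurvivingExt.1⟩) fun i hi h ↦ ?_
    obtain ⟨l, hl⟩ := (hasSurvivingExt_of_isInternal hQ).1 h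
    exact (hdepth l).hasSurvivingExt.2 i (hi.trans_le (hl₀ l)) hl
  rw [hS]
  refine ⟨⟨l₀, n - l₀, by omega, rfl⟩, ?_⟩
  rintro _ ⟨i, j, rfl, rfl⟩
  have := hl₀ ⟨i, by omega⟩
  simpa [hv] using this

end Depth

section Stability

theorem eq_of_stable {a : ℕ → ℕ} {m L : ℕ} (h : ∀ i, m ≤ i → a i = a (i + 1))
    (hL : ∀ᶠ i in Filter.atTop, a i = L) {i : ℕ} (hi : m ≤ i) : a i = L := by
  obtain ⟨N, hN⟩ := Filter.eventually_atTop.1 hL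
  have hadd (t : ℕ) : a (i + t) = a i := by
    induction t with
    | zero => rfl
    | succ t ih => rw [← ih, ← add_assoc, ← h _ (hi.trans (Nat.le_add_right i t))]
  rw [← hadd N, hN _ (Nat.le_add_left N i)]

theorem exists_stable_index_le {a : ℕ → ℕ} {m L : ℕ} (hm : 1 ≤ m) (h : ∀ i, m ≤ i → a i = L)
    {i : ℕ} (hi : 1 ≤ i) : ∃ j, 1 ≤ j ∧ j ≤ m ∧ a j = a i := by
  obtain him | him := le_total i m
  · exact ⟨i, hi, him, rfl⟩
  · exact ⟨m, hm, le_rfl, by rw [h m le_rfl, h i him]⟩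

theorem sInf_window_le {a : ℕ → ℕ} {m L : ℕ} (hm : 1 ≤ m) (h : ∀ i, m ≤ i → a i = L)
    {i : ℕ} (hi : 1 ≤ i) : sInf {v | ∃ j, 1 ≤ j ∧ j ≤ m ∧ v = a j} ≤ a i := by
  obtain ⟨j, hj, hjm, hji⟩ := exists_stable_index_le hm h hi
  exact Nat.sInf_le ⟨j, hj, hjm, hji.symm⟩

theorem exists_eq_sInf_window {a : ℕ → ℕ} {m : ℕ} (hm : 1 ≤ m) :
    ∃ j, 1 ≤ j ∧ j ≤ m ∧ sInf {v | ∃ j, 1 ≤ j ∧ j ≤ m ∧ v = a j} = a j :=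
  Nat.sInf_mem (s := {v | ∃ j, 1 ≤ j ∧ j ≤ m ∧ v = a j}) ⟨a 1, 1, le_rfl, hm, rfl⟩

/-- The minimal value of `a i + b j` on the diagonal `i + j = n + 1`, once it is long enough for
one of the two eventually constant sequences to be stable everywhere on it. -/
theorem eq_min_of_isLeast {a b : ℕ → ℕ} {m m' L L' n d : ℕ} (hm : 1 ≤ m) (hm' : 1 ≤ m')
    (ha : ∀ i, m ≤ i → a i = L) (hb : ∀ j, m' ≤ j → b j = L') (hn : m + m' - 1 ≤ n)
    (hd : IsLeast {v | ∃ i j, 1 ≤ i ∧ 1 ≤ j ∧ i + j = n + 1 ∧ v = a i + b j} d) :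
    d = min (L + sInf {v | ∃ j, 1 ≤ j ∧ j ≤ m' ∧ v = b j})
      (sInf {v | ∃ i, 1 ≤ i ∧ i ≤ m ∧ v = a i} + L') := by
  apply le_antisymm
  · refine le_min ?_ ?_
    · obtain ⟨j, hj, hjm, h⟩ := exists_eq_sInf_window (a := b) hm'
      rw [h, ← ha (n + 1 - j) (by omega)]
      exact hd.2 ⟨n + 1 - j, j, by omega, hj, by omega, rfl⟩
    · obtain ⟨i, hi, him, h⟩ := exists_eq_sInf_window (a := a) hm
      rw [h, ← hb (n + 1 - i) (by omega)]
      exact hd.2 ⟨i, n + 1 - i, hi, by omega, by omega, rfl⟩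
  · obtain ⟨i, j, hi, hj, hij, rfl⟩ := hd.1
    obtain him | hjm : m ≤ i ∨ m' ≤ j := by omega
    · rw [ha i him]
      exact (min_le_left _ _).trans (Nat.add_le_add_left (sInf_window_le hm' hb hj) L)
    · rw [hb j hjm]
      exact (min_le_right _ _).trans (Nat.add_le_add_right (sInf_window_le hm ha hi) L')

end Stability

end

open PaperHTT in
/-- Proposition 4.2: with `s(I)`, `s(J)` the stability indices of the depth functions of the
successive quotients of powers, for `n ≥ s(I) + s(J) - 1`:
`depth (I+J)^(n-1)/(I+J)^n = min (lim_i depth I^(i-1)/I^i + min_(1 ≤ j ≤ s(J)) depth J^(j-1)/J^j,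
min_(1 ≤ i ≤ s(I)) depth I^(i-1)/I^i + lim_j depth J^(j-1)/J^j)`. -/
theorem depth_successive_quot_stable
    (k : Type) [Field k] (r s : ℕ)
    (I : Ideal (PA k r)) (J : Ideal (PB k s))
    (hI0 : I ≠ ⊥) (hI1 : I ≠ ⊤) (hIh : IsHomogeneousIdeal k I)
    (hJ0 : J ≠ ⊥) (hJ1 : J ≠ ⊤) (hJh : IsHomogeneousIdeal k J)
    (sI sJ : ℕ) (hsI1 : 1 ≤ sI) (hsJ1 : 1 ≤ sJ)
    (hIstab : ∀ i : ℕ, sI ≤ i → 1 ≤ i →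
      depthSubQuot k (I ^ (i - 1)) (I ^ i) = depthSubQuot k (I ^ i) (I ^ (i + 1)))
    (hIleast : ∀ m : ℕ, 1 ≤ m →
      (∀ i : ℕ, m ≤ i → 1 ≤ i →
        depthSubQuot k (I ^ (i - 1)) (I ^ i) = depthSubQuot k (I ^ i) (I ^ (i + 1))) →
      sI ≤ m)
    (hJstab : ∀ i : ℕ, sJ ≤ i → 1 ≤ i →
      depthSubQuot k (J ^ (i - 1)) (J ^ i) = depthSubQuot k (J ^ i) (J ^ (i + 1)))
    (hJleast : ∀ m : ℕ, 1 ≤ m →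
      (∀ i : ℕ, m ≤ i → 1 ≤ i →
        depthSubQuot k (J ^ (i - 1)) (J ^ i) = depthSubQuot k (J ^ i) (J ^ (i + 1))) →
      sJ ≤ m)
    (LI LJ : ℕ)
    (hLI : ∀ᶠ i in Filter.atTop, depthSubQuot k (I ^ (i - 1)) (I ^ i) = LI)
    (hLJ : ∀ᶠ j in Filter.atTop, depthSubQuot k (J ^ (j - 1)) (J ^ j) = LJ)
    (n : ℕ) (hn : sI + sJ - 1 ≤ n) :
    depthSubQuot k ((sumIJ k I J) ^ (n - 1)) ((sumIJ k I J) ^ n) =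
      min (LI + sInf {v : ℕ | ∃ j, 1 ≤ j ∧ j ≤ sJ ∧ v = depthSubQuot k (J ^ (j - 1)) (J ^ j)})
        (sInf {v : ℕ | ∃ i, 1 ≤ i ∧ i ≤ sI ∧ v = depthSubQuot k (I ^ (i - 1)) (I ^ i)} + LJ) := by
  refine eq_min_of_isLeast (a := fun i ↦ depthSubQuot k (I ^ (i - 1)) (I ^ i))
    (b := fun j ↦ depthSubQuot k (J ^ (j - 1)) (J ^ j)) hsI1 hsJ1
    (fun i ↦ eq_of_stable (fun i hi ↦ hIstab i hi (hsI1.trans hi)) hLI)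
    (fun j ↦ eq_of_stable (fun j hj ↦ hJstab j hj (hsJ1.trans hj)) hLJ) hn ?_
  obtain ⟨n, rfl⟩ : ∃ n', n = n' + 1 := ⟨n - 1, by omega⟩
  rw [Nat.add_sub_cancel]
  convert isLeast_depthSubQuot_sumIJ hI0 hI1 hIh hJ0 hJ1 hJh n using 1
  ext v
  constructor
  · rintro ⟨i, j, hi, hj, hij, rfl⟩
    refine ⟨i - 1, j - 1, by omega, ?_⟩
    simp only [Nat.sub_add_cancel hi, Nat.sub_add_cancel hj]
  · rintro ⟨i, j, hij, rfl⟩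
    exact ⟨i + 1, j + 1, by omega, by omega, by omega, rfl⟩
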